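/- arXiv:2412.04336 — 2 statements merged into one kernel-verified Lean document; each statement's English description precedes it below -/
import Mathlib

section
/- Fix m ∈ (0,1). There exist constants C > 0 and ε₀ > 0 such that for all ε ∈ (0, ε₀) and all sufficiently large N, E[M_{N,m,ε}]/√N ≤ ((1−m²)/(2√I(m))) · (log(CN))/N + (1−m²)√I(m) + Cε, where M_{N,m,ε} := max{X_σ : σ ∈ S_{N,m,ε}} and X_σ := (1/√(2N)) Σ_{1≤i,j≤N} g_{ij} σ̂_i σ̂_j. -/
open MeasureTheory ProbabilityTheory Real Filter
open scoped NNReal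

noncomputable section

/-- The law of the i.i.d. Gaussian couplings `(g_{ij})_{1 ≤ i,j ≤ N}`, each `N(0, 1/N)`. -/
def couplings (N : ℕ) : Measure (Fin N × Fin N → ℝ) :=
  Measure.pi fun _ : Fin N × Fin N => gaussianReal 0 ((N : ℝ≥0))⁻¹

/-- The spin value (`±1`) encoded by a Boolean. -/
def spin (b : Bool) : ℝ := if b then 1 else -1

/-- The base product measure weight `p_m(σ) = ∏ i, (1 + m σ_i)/2`. -/
def pm (N : ℕ) (m : ℝ) (σ : Fin N → Bool) : ℝ :=
  ∏ i : Fin N, (1 + m * spin (σ i)) / 2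

/-- The Hamiltonian `H_{N,β,m}(σ)`. -/
def ham (N : ℕ) (β m : ℝ) (g : Fin N × Fin N → ℝ) (σ : Fin N → Bool) : ℝ :=
  (β / Real.sqrt 2) * ∑ i : Fin N, ∑ j : Fin N,
      g (i, j) * (spin (σ i) - m) * (spin (σ j) - m)
    - (β ^ 2 / (4 * N)) * ∑ i : Fin N, ∑ j : Fin N,
      (spin (σ i) - m) ^ 2 * (spin (σ j) - m) ^ 2

/-- The partition function `Z_{N,β,m}`. -/
def Z (N : ℕ) (β m : ℝ) (g : Fin N × Fin N → ℝ) : ℝ :=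
  ∑ σ : Fin N → Bool, pm N m σ * Real.exp (ham N β m g σ)

/-- The set `S_{N,m,ε}` of configurations whose empirical magnetization is `ε`-close to `m`. -/
def SNset (N : ℕ) (m ε : ℝ) : Finset (Fin N → Bool) :=
  Finset.univ.filter fun σ =>
    (N : ℝ)⁻¹ * (∑ i : Fin N, spin (σ i)) ∈ Set.Icc (m - ε) (m + ε)

/-- The restricted partition function `Z^{≤ε}_{N,β,m}`. -/
def Zres (N : ℕ) (β m ε : ℝ) (g : Fin N × Fin N → ℝ) : ℝ :=
  ∑ σ ∈ SNset N m ε, pm N m σ * Real.exp (ham N β m g σ)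

/-- The quenched free energy `E[(1/N) log Z_{N,β,m}]`. -/
def F (N : ℕ) (β m : ℝ) : ℝ :=
  ∫ g, (N : ℝ)⁻¹ * Real.log (Z N β m g) ∂(couplings N)

/-- The restricted quenched free energy `F^{≤ε}_{N,β,m} = E[(1/N) log Z^{≤ε}_{N,β,m}]`. -/
def Fres (N : ℕ) (β m ε : ℝ) : ℝ :=
  ∫ g, (N : ℝ)⁻¹ * Real.log (Zres N β m ε g) ∂(couplings N)

/-- The binary entropy function `I`. -/
def binEnt (s : ℝ) : ℝ :=
  -((1 + s) / 2) * Real.log ((1 + s) / 2) - ((1 - s) / 2) * Real.log ((1 - s) / 2)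

/-- The centered Gaussian field `X_σ = (2N)^{-1/2} Σ_{ij} g_{ij} σ̂_i σ̂_j`. -/
def Xg (N : ℕ) (m : ℝ) (g : Fin N × Fin N → ℝ) (σ : Fin N → Bool) : ℝ :=
  (Real.sqrt (2 * N))⁻¹ * ∑ i : Fin N, ∑ j : Fin N,
    g (i, j) * (spin (σ i) - m) * (spin (σ j) - m)

/-- The maximum `M_{N,m,ε} = max {X_σ : σ ∈ S_{N,m,ε}}`. -/
def Mmax (N : ℕ) (m ε : ℝ) (g : Fin N × Fin N → ℝ) : ℝ :=
  sSup ((fun σ => Xg N m g σ) '' (SNset N m ε : Set (Fin N → Bool)))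

end

lemma Xg_eq_sum_mul (N : ℕ) (m t : ℝ) (g : Fin N × Fin N → ℝ) (σ : Fin N → Bool) :
    t * Xg N m g σ = ∑ p : Fin N × Fin N,
      (t * (Real.sqrt (2 * N))⁻¹ * (spin (σ p.1) - m) * (spin (σ p.2) - m)) * g p := by
  rw [Xg, Fintype.sum_prod_type, Finset.mul_sum, Finset.mul_sum]
  refine Finset.sum_congr rfl fun i _ => ?_
  rw [Finset.mul_sum, Finset.mul_sum]
  exact Finset.sum_congr rfl fun j _ => by ring

lemma integrable_exp_mul_Xg (N : ℕ) (m t : ℝ) (σ : Fin N → Bool) :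
    Integrable (fun g => Real.exp (t * Xg N m g σ)) (couplings N) := by
  simp_rw [Xg_eq_sum_mul, Real.exp_sum]
  exact Integrable.fintype_prod (f := fun (p : Fin N × Fin N) (x : ℝ) =>
    Real.exp ((t * (Real.sqrt (2 * N))⁻¹ * (spin (σ p.1) - m) * (spin (σ p.2) - m)) * x))
    fun p => integrable_exp_mul_gaussianReal _

lemma integral_exp_mul_Xg (N : ℕ) (m t : ℝ) (σ : Fin N → Bool) :
    ∫ g, Real.exp (t * Xg N m g σ) ∂(couplings N) =
      Real.exp (t ^ 2 / (4 * N ^ 2) * (∑ i, (spin (σ i) - m) ^ 2) ^ 2) := by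
  have hgauss (c : ℝ) : ∫ x, Real.exp (c * x) ∂(gaussianReal 0 ((N : ℝ≥0))⁻¹) =
      Real.exp ((N : ℝ)⁻¹ * c ^ 2 / 2) := by
    have h := congrFun (mgf_fun_id_gaussianReal (μ := 0) (v := ((N : ℝ≥0))⁻¹)) c
    simpa [mgf] using h
  simp_rw [Xg_eq_sum_mul, Real.exp_sum]
  rw [couplings, integral_fintype_prod_eq_prod (fun (p : Fin N × Fin N) (x : ℝ) =>
    Real.exp ((t * (Real.sqrt (2 * N))⁻¹ * (spin (σ p.1) - m) * (spin (σ p.2) - m)) * x))]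
  simp_rw [hgauss]
  rw [← Real.exp_sum, sq (∑ i, (spin (σ i) - m) ^ 2), Finset.sum_mul_sum,
    Fintype.sum_prod_type, Finset.mul_sum]
  congr 1
  refine Finset.sum_congr rfl fun i _ => ?_
  rw [Finset.mul_sum]
  refine Finset.sum_congr rfl fun j _ => ?_
  have hs : (Real.sqrt (2 * N))⁻¹ ^ 2 = (2 * (N : ℝ))⁻¹ := by
    rw [inv_pow, Real.sq_sqrt (by positivity)]
  simp only [mul_pow, hs]
  rcases eq_or_ne (N : ℝ) 0 with h | h
  · simp [h]
  · field_simp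
    ring

lemma SNset_sum_spin_ge {N : ℕ} (hN : 0 < N) {m ε : ℝ} {σ : Fin N → Bool}
    (hσ : σ ∈ SNset N m ε) : N * (m - ε) ≤ ∑ i, spin (σ i) := by
  have h : m - ε ≤ (N : ℝ)⁻¹ * ∑ i, spin (σ i) := (Finset.mem_filter.1 hσ).2.1
  have hN' : (0 : ℝ) < N := by exact_mod_cast hN
  rwa [inv_mul_eq_div, le_div_iff₀ hN', mul_comm] at h

lemma SNset_sum_sq_le {N : ℕ} (hN : 0 < N) {m ε : ℝ} (hm : 0 ≤ m) {σ : Fin N → Bool}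
    (hσ : σ ∈ SNset N m ε) :
    ∑ i, (spin (σ i) - m) ^ 2 ≤ N * (1 - m ^ 2 + 2 * m * ε) := by
  have h1 : ∑ i, (spin (σ i) - m) ^ 2 = N * (1 + m ^ 2) - 2 * m * ∑ i, spin (σ i) := by
    have h (b : Bool) : (spin b - m) ^ 2 = (1 + m ^ 2) - 2 * m * spin b := by
      cases b <;> simp [spin] <;> ring
    simp_rw [h]
    rw [Finset.sum_sub_distrib, Finset.mul_sum]
    simp
    ring
  nlinarith [mul_le_mul_of_nonneg_left (SNset_sum_spin_ge hN hσ) hm]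

lemma sum_pm (N : ℕ) (m : ℝ) : ∑ σ : Fin N → Bool, pm N m σ = 1 := by
  simp only [pm]
  rw [← Fintype.prod_sum (fun (_ : Fin N) (b : Bool) => (1 + m * spin b) / 2)]
  refine Finset.prod_eq_one fun i _ => ?_
  simp [spin]
  ring

lemma pm_eq_exp (N : ℕ) {m : ℝ} (hm : m ∈ Set.Ioo (0 : ℝ) 1) (σ : Fin N → Bool) :
    pm N m σ = Real.exp (-(N * binEnt m) +
      (∑ i, spin (σ i) - N * m) * ((Real.log ((1 + m) / 2) - Real.log ((1 - m) / 2)) / 2)) := by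
  obtain ⟨h0, h1⟩ := hm
  have hspin (b : Bool) : (1 + m * spin b) / 2 = Real.exp (-binEnt m +
      (spin b - m) * ((Real.log ((1 + m) / 2) - Real.log ((1 - m) / 2)) / 2)) := by
    cases b
    · rw [← Real.exp_log (show 0 < (1 + m * spin false) / 2 by simp [spin]; linarith)]
      simp only [spin, binEnt]
      norm_num
      ring_nf
    · rw [← Real.exp_log (show 0 < (1 + m * spin true) / 2 by simp [spin]; linarith)]
      simp only [spin, binEnt]
      norm_num
      ring_nf
  simp only [pm, hspin]
  rw [← Real.exp_sum, Finset.sum_add_distrib, ← Finset.sum_mul, Finset.sum_sub_distrib]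
  simp

lemma SNset_card_le {N : ℕ} (hN : 0 < N) {m ε : ℝ} (hm : m ∈ Set.Ioo (0 : ℝ) 1) :
    ((SNset N m ε).card : ℝ) ≤ Real.exp (N * (binEnt m +
      ε * ((Real.log ((1 + m) / 2) - Real.log ((1 - m) / 2)) / 2))) := by
  set L := (Real.log ((1 + m) / 2) - Real.log ((1 - m) / 2)) / 2 with hL
  obtain ⟨h0, h1⟩ := id hm
  have hL0 : 0 ≤ L := by
    have := Real.log_le_log (show 0 < (1 - m) / 2 by linarith)
      (show (1 - m) / 2 ≤ (1 + m) / 2 by linarith)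
    linarith
  have hle : ∀ σ ∈ SNset N m ε, Real.exp (-(N * (binEnt m + ε * L))) ≤ pm N m σ := by
    intro σ hσ
    rw [pm_eq_exp N hm, ← hL]
    refine Real.exp_le_exp.2 ?_
    nlinarith [mul_le_mul_of_nonneg_right (SNset_sum_spin_ge hN hσ) hL0]
  have hsum : ((SNset N m ε).card : ℝ) * Real.exp (-(N * (binEnt m + ε * L))) ≤ 1 := by
    rw [← sum_pm N m, ← nsmul_eq_mul]
    refine (Finset.card_nsmul_le_sum _ _ _ hle).trans ?_
    refine Finset.sum_le_sum_of_subset_of_nonneg (Finset.subset_univ _) fun σ _ _ => ?_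
    rw [pm_eq_exp N hm]
    positivity
  rwa [Real.exp_neg, mul_inv_le_iff₀ (Real.exp_pos _), one_mul] at hsum

lemma integral_Mmax_le {N : ℕ} {m ε t K B : ℝ} (ht : 0 < t)
    (hint : Integrable (Mmax N m ε) (couplings N)) (hne : (SNset N m ε).Nonempty)
    (hK : ((SNset N m ε).card : ℝ) ≤ Real.exp K)
    (hB : ∀ σ ∈ SNset N m ε, ∫ g, Real.exp (t * Xg N m g σ) ∂(couplings N) ≤ Real.exp B) :
    ∫ g, Mmax N m ε g ∂(couplings N) ≤ (K + B) / t := by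
  have : IsProbabilityMeasure (couplings N) := by unfold couplings; infer_instance
  have hpt (g : Fin N × Fin N → ℝ) : Mmax N m ε g ≤ t⁻¹ * ((K + B - 1) +
      Real.exp (-(K + B)) * ∑ σ ∈ SNset N m ε, Real.exp (t * Xg N m g σ)) := by
    refine csSup_le ((Finset.coe_nonempty.2 hne).image _) ?_
    rintro _ ⟨σ, hσ, rfl⟩
    have hsingle := Finset.single_le_sum
      (fun τ _ => (Real.exp_pos (t * Xg N m g τ)).le) (Finset.mem_coe.1 hσ)
    have hexp := Real.add_one_le_exp (t * Xg N m g σ - (K + B))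
    rw [sub_eq_neg_add, Real.exp_add] at hexp
    have := mul_le_mul_of_nonneg_left hsingle (Real.exp_pos (-(K + B))).le
    rw [inv_mul_eq_div, le_div_iff₀ ht]
    linarith
  have hintS : Integrable (fun g => ∑ σ ∈ SNset N m ε, Real.exp (t * Xg N m g σ))
      (couplings N) := integrable_finsetSum _ fun σ _ => integrable_exp_mul_Xg N m t σ
  refine (integral_mono hint
    (((integrable_const _).add (hintS.const_mul _)).const_mul _) hpt).trans ?_
  rw [integral_const_mul]
  have hsum : ∫ g, ∑ σ ∈ SNset N m ε, Real.exp (t * Xg N m g σ) ∂(couplings N) ≤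
      Real.exp (K + B) := by
    rw [integral_finsetSum _ fun σ _ => integrable_exp_mul_Xg N m t σ]
    refine (Finset.sum_le_card_nsmul _ _ _ hB).trans ?_
    rw [nsmul_eq_mul, Real.exp_add]
    gcongr
  rw [integral_add' (integrable_const _) (hintS.const_mul _), integral_const_mul]
  have := mul_le_mul_of_nonneg_left hsum (Real.exp_pos (-(K + B))).le
  rw [← Real.exp_add, neg_add_cancel, Real.exp_zero] at this
  simp only [integral_const, probReal_univ, one_smul]
  rw [inv_mul_eq_div]
  refine div_le_div_of_nonneg_right ?_ ht.le
  linarith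

lemma binEnt_pos {m : ℝ} (hm : m ∈ Set.Ioo (0 : ℝ) 1) : 0 < binEnt m := by
  obtain ⟨h0, h1⟩ := hm
  have ha := Real.log_neg (show 0 < (1 + m) / 2 by linarith) (by linarith)
  have hb := Real.log_neg (show 0 < (1 - m) / 2 by linarith) (by linarith)
  unfold binEnt
  nlinarith [mul_pos (show 0 < (1 + m) / 2 by linarith) (neg_pos.2 ha),
    mul_pos (show 0 < (1 - m) / 2 by linarith) (neg_pos.2 hb)]

/-- for fixed `m ∈ (0,1)` there are `C, ε₀ > 0` such that for all `ε ∈ (0, ε₀)` and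
all sufficiently large `N`,
`E[M_{N,m,ε}]/√N ≤ ((1-m²)/(2√I(m))) log(CN)/N + (1-m²)√I(m) + Cε`. -/
theorem statement6 (m : ℝ) (hm : m ∈ Set.Ioo (0 : ℝ) 1) :
    ∃ C > (0 : ℝ), ∃ ε₀ > (0 : ℝ), ∀ ε ∈ Set.Ioo (0 : ℝ) ε₀, ∀ᶠ N : ℕ in atTop,
      (∫ g, Mmax N m ε g ∂(couplings N)) / Real.sqrt N ≤
        (1 - m ^ 2) / (2 * Real.sqrt (binEnt m)) * (Real.log (C * N) / N)
          + (1 - m ^ 2) * Real.sqrt (binEnt m) + C * ε := by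
  obtain ⟨h0, h1⟩ := id hm
  set L := (Real.log ((1 + m) / 2) - Real.log ((1 - m) / 2)) / 2 with hL
  have hL0 : 0 ≤ L := by
    have := Real.log_le_log (show 0 < (1 - m) / 2 by linarith)
      (show (1 - m) / 2 ≤ (1 + m) / 2 by linarith)
    linarith
  have hI := binEnt_pos hm
  set s := Real.sqrt (binEnt m) with hs
  have hs0 : 0 < s := Real.sqrt_pos.2 hI
  have hs2 : s ^ 2 = binEnt m := Real.sq_sqrt hI.le
  set D := 1 - m ^ 2 with hD
  have hD0 : 0 < D := by nlinarith
  set C := 1 + L * D / (2 * s) + 4 * s / D with hC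
  have hC1 : 1 ≤ C := by
    have h₁ : 0 ≤ L * D / (2 * s) := by positivity
    have h₂ : 0 ≤ 4 * s / D := by positivity
    linarith
  refine ⟨C, by linarith, 1, one_pos, fun ε hε => ?_⟩
  obtain ⟨hε0, hε1⟩ := hε
  filter_upwards [eventually_ge_atTop 1] with N hN
  have hN1 : (1 : ℝ) ≤ N := by exact_mod_cast hN
  have hlog : 0 ≤ D / (2 * s) * (Real.log (C * N) / N) := by
    have := Real.log_nonneg (one_le_mul_of_one_le_of_one_le hC1 hN1)
    positivity
  suffices h : (∫ g, Mmax N m ε g ∂(couplings N)) / Real.sqrt N ≤ D * s + C * ε by linarith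
  have hrhs : 0 ≤ D * s + C * ε := by positivity
  by_cases hint : Integrable (Mmax N m ε) (couplings N)
  swap
  · rwa [integral_undef hint, zero_div]
  rcases (SNset N m ε).eq_empty_or_nonempty with hemp | hne
  · simpa [Mmax, hemp] using hrhs
  set r := Real.sqrt N with hr
  have hr0 : 0 < r := Real.sqrt_pos.2 (by linarith)
  have hr2 : r ^ 2 = N := Real.sq_sqrt (by linarith)
  set w := D + 2 * m * ε with hw
  have hbound := integral_Mmax_le (N := N) (m := m) (ε := ε) (t := 2 * r * s / D)
    (K := N * (binEnt m + ε * L)) (B := (2 * r * s / D) ^ 2 * w ^ 2 / 4)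
    (by positivity) hint hne (SNset_card_le hN hm) fun σ hσ => by
      rw [integral_exp_mul_Xg]
      have hQ := pow_le_pow_left₀ (Finset.sum_nonneg fun i _ => sq_nonneg (spin (σ i) - m))
        (SNset_sum_sq_le hN h0.le hσ) 2
      refine Real.exp_le_exp.2 ((mul_le_mul_of_nonneg_left hQ (by positivity)).trans_eq ?_)
      rw [← hD, ← hw]
      field_simp
  have hw2 : w ^ 2 ≤ D ^ 2 + 8 * ε := by
    have hD1 : D ≤ 1 := by nlinarith
    have hmD : m * D ≤ 1 := by nlinarith
    have hm2 : m ^ 2 * ε ≤ 1 := by nlinarith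
    nlinarith [mul_le_mul_of_nonneg_right hmD hε0.le, mul_le_mul_of_nonneg_right hm2 hε0.le]
  calc (∫ g, Mmax N m ε g ∂(couplings N)) / r
      ≤ ((N * (binEnt m + ε * L) + (2 * r * s / D) ^ 2 * w ^ 2 / 4) / (2 * r * s / D)) / r := by
        gcongr
    _ = (s ^ 2 + ε * L) * D / (2 * s) + s / (2 * D) * w ^ 2 := by
        rw [← hs2, ← hr2]
        field_simp
        ring
    _ ≤ (s ^ 2 + ε * L) * D / (2 * s) + s / (2 * D) * (D ^ 2 + 8 * ε) := by gcongr
    _ = D * s + (C - 1) * ε := by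
        rw [hC]
        field_simp
        ring
    _ ≤ D * s + C * ε := by nlinarith
end

section
/- For every β ≥ 0, m ∈ (−1,1), ε > 0 and δ > 0, and for all sufficiently large N, P(Z^{≤ε}_{N,β,m} ≤ e^{−δN}) ≤ P((1/N) log Z_{N,β,m} ≤ −δ/2) + e^{δN} · p_m(S_{N,m,ε}^∁), where p_m(S_{N,m,ε}^∁) = Σ_{σ∉S_{N,m,ε}} p_m(σ). -/
open MeasureTheory ProbabilityTheory Real Filter
open scoped NNReal

lemma pm_pos {N : ℕ} {m : ℝ} (hm : m ∈ Set.Ioo (-1 : ℝ) 1) (σ : Fin N → Bool) :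
    0 < pm N m σ := by
  refine Finset.prod_pos fun i _ => ?_
  obtain ⟨h1, h2⟩ := hm
  unfold spin
  split_ifs <;> linarith

/-- The exponential moment of a linear functional of the couplings. -/
lemma integrable_exp_linear_couplings (N : ℕ) (c : Fin N × Fin N → ℝ) :
    Integrable (fun g => Real.exp (∑ p, c p * g p)) (couplings N) ∧
      ∫ g, Real.exp (∑ p, c p * g p) ∂(couplings N)
        = Real.exp (∑ p, (N : ℝ)⁻¹ * c p ^ 2 / 2) := by
  simp only [Real.exp_sum, couplings]
  refine ⟨Integrable.fintype_prod (f := fun p x => Real.exp (c p * x))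
    fun p => integrable_exp_mul_gaussianReal (c p), ?_⟩
  rw [integral_fintype_prod_eq_prod (fun p x => Real.exp (c p * x))]
  refine Finset.prod_congr rfl fun p _ => ?_
  have h := congrFun (mgf_fun_id_gaussianReal (μ := 0) (v := ((N : ℝ≥0))⁻¹)) (c p)
  simpa [mgf] using h

lemma ham_eq_linear (N : ℕ) (β m : ℝ) (g : Fin N × Fin N → ℝ) (σ : Fin N → Bool) :
    ham N β m g σ =
      ∑ p, ((β / Real.sqrt 2) * (spin (σ p.1) - m) * (spin (σ p.2) - m)) * g p
        - ∑ p : Fin N × Fin N, (N : ℝ)⁻¹ *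
          ((β / Real.sqrt 2) * (spin (σ p.1) - m) * (spin (σ p.2) - m)) ^ 2 / 2 := by
  have h2 : Real.sqrt 2 ^ 2 = 2 := Real.sq_sqrt (by norm_num)
  simp only [ham, Fintype.sum_prod_type, Finset.mul_sum]
  congr 1 <;> refine Finset.sum_congr rfl fun i _ => Finset.sum_congr rfl fun j _ => ?_
  · ring
  · rw [mul_pow, mul_pow, div_pow, h2]
    ring

/-- The Boltzmann weight of each configuration is normalised to have mean one. -/
lemma integrable_exp_ham (N : ℕ) (β m : ℝ) (σ : Fin N → Bool) :
    Integrable (fun g => Real.exp (ham N β m g σ)) (couplings N) ∧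
      ∫ g, Real.exp (ham N β m g σ) ∂(couplings N) = 1 := by
  simp only [ham_eq_linear, Real.exp_sub]
  have h := integrable_exp_linear_couplings N
    fun p => (β / Real.sqrt 2) * (spin (σ p.1) - m) * (spin (σ p.2) - m)
  refine ⟨h.1.div_const _, ?_⟩
  rw [integral_div, h.2, div_self (Real.exp_pos _).ne']

instance isProbabilityMeasure_couplings (N : ℕ) : IsProbabilityMeasure (couplings N) := by
  unfold couplings
  infer_instance

/-- Markov's inequality for the partition function restricted to a set of configurations. -/
lemma couplings_real_sum_ge_le {N : ℕ} {m : ℝ} (β t : ℝ) (hm : m ∈ Set.Ioo (-1 : ℝ) 1)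
    (s : Finset (Fin N → Bool)) :
    t * (couplings N).real {g | t ≤ ∑ σ ∈ s, pm N m σ * Real.exp (ham N β m g σ)} ≤
      ∑ σ ∈ s, pm N m σ := by
  have hint : ∀ σ ∈ s, Integrable (fun g => pm N m σ * Real.exp (ham N β m g σ))
      (couplings N) := fun σ _ => (integrable_exp_ham N β m σ).1.const_mul _
  refine (mul_meas_ge_le_integral_of_nonneg (.of_forall fun g => Finset.sum_nonneg fun σ _ =>
    mul_nonneg (pm_pos hm σ).le (Real.exp_pos _).le) (integrable_finsetSum s hint) t).trans_eq ?_
  rw [integral_finsetSum s hint]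
  exact Finset.sum_congr rfl fun σ _ => by
    rw [integral_const_mul, (integrable_exp_ham N β m σ).2, mul_one]

/-- for all sufficiently large `N`,
`P(Z^{≤ε} ≤ e^{-δN}) ≤ P((1/N) log Z ≤ -δ/2) + e^{δN} p_m(S^∁)`. -/
theorem statement16 (β m ε δ : ℝ) (hβ : 0 ≤ β)
    (hm : m ∈ Set.Ioo (-1 : ℝ) 1) (hε : 0 < ε) (hδ : 0 < δ) :
    ∀ᶠ N : ℕ in atTop,
      (couplings N {g | Zres N β m ε g ≤ Real.exp (-δ * N)}).toReal ≤
        (couplings N {g | (N : ℝ)⁻¹ * Real.log (Z N β m g) ≤ -δ / 2}).toReal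
          + Real.exp (δ * N) * ∑ σ ∈ (SNset N m ε)ᶜ, pm N m σ := by
  filter_upwards [eventually_ge_atTop (max 1 ⌈2 * Real.log 2 / δ⌉₊)] with N hN
  have hN1 : (0 : ℝ) < N := by exact_mod_cast (le_max_left 1 _).trans hN
  have hN2 : 2 * Real.log 2 / δ ≤ N :=
    (Nat.le_ceil _).trans (by exact_mod_cast (le_max_right 1 _).trans hN)
  rw [div_le_iff₀ hδ] at hN2
  let B : Set (Fin N × Fin N → ℝ) := {g | Real.exp (-δ * N) ≤
    ∑ σ ∈ (SNset N m ε)ᶜ, pm N m σ * Real.exp (ham N β m g σ)}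
  have hB : (couplings N).real B ≤
      Real.exp (δ * N) * ∑ σ ∈ (SNset N m ε)ᶜ, pm N m σ := by
    have h := mul_le_mul_of_nonneg_left
      (couplings_real_sum_ge_le β (Real.exp (-δ * N)) hm (SNset N m ε)ᶜ)
      (Real.exp_pos (δ * N)).le
    rwa [← mul_assoc, ← Real.exp_add, neg_mul, add_neg_cancel, Real.exp_zero, one_mul,
      ← neg_mul] at h
  refine (measureReal_mono (s₂ := {g | (N : ℝ)⁻¹ * Real.log (Z N β m g) ≤ -δ / 2} ∪ B)
    fun g hg => ?_).trans ((measureReal_union_le _ _).trans (by gcongr; exact le_rfl))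
  by_cases hgB : g ∈ B
  · exact Or.inr hgB
  refine Or.inl ?_
  simp only [B, Set.mem_ofPred_eq, not_le] at hgB hg ⊢
  have hsum : Zres N β m ε g + ∑ σ ∈ (SNset N m ε)ᶜ, pm N m σ * Real.exp (ham N β m g σ)
      = Z N β m g := Finset.sum_add_sum_compl _ _
  have hpos : 0 < Z N β m g := Finset.sum_pos
    (fun σ _ => mul_pos (pm_pos hm σ) (Real.exp_pos _)) Finset.univ_nonempty
  have hlog : Real.log (Z N β m g) ≤ Real.log 2 + -δ * N := by
    rw [Real.log_le_iff_le_exp hpos, Real.exp_add, Real.exp_log two_pos]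
    linarith
  rw [inv_mul_le_iff₀ hN1]
  linarith
end
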